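/- (Filter for Σ_P.) Let X = (X_t)_{t≥0} and Y = (Y_t)_{t≥0} be processes with values in the standard bases E of ℝ^n and F of ℝ^m respectively; set Z_t = Y_t ⊗ X_t, 𝓕_t = σ(X_0,…,X_t, Y_0,…,Y_t), and 𝓕^Y_t = σ(Y_0,…,Y_t). Assume there is an (mn)×n matrix Q̄, written in blocks Q̄ = [Q_1; … ; Q_m] with each Q_j ∈ ℝ^{n×n}, such that E[Z_{t+1} | 𝓕_t] = Q̄ X_t almost surely for all t. Define the filter X̂_t = E[X_t | 𝓕^Y_t], A = Σ_{j=1}^m Q_j and C = (I_m ⊗ 1_n^T) Q̄. Then for every t ≥ 1 and every j ∈ {1,…,m}: almost surely on the event {Y_t = f_j} one has 1_n^T Q_j X̂_{t−1} > 0 and X̂_t = Q_j X̂_{t−1} / (1_n^T Q_j X̂_{t−1}); moreover E[X_{t+1} | 𝓕^Y_t] = A X̂_t and E[Y_{t+1} | 𝓕^Y_t] = C X̂_t almost surely for all t. -/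

import Mathlib

open MeasureTheory Matrix ProbabilityTheory
open scoped Kronecker

noncomputable section

/-- The `i`-th standard basis vector of `ℝ^n`. -/
def stdBasis (n : ℕ) (i : Fin n) : Fin n → ℝ := fun k => if k = i then 1 else 0

/-- The operator `Δ(G)`: the `(mn) × n` matrix obtained by stacking the diagonal matrices of
the rows of `G`; its `((j,i), k)` entry is `G j i` if `k = i` and `0` otherwise. -/
def deltaOp {m n : ℕ} (G : Matrix (Fin m) (Fin n) ℝ) :
    Matrix (Fin m × Fin n) (Fin n) ℝ :=
  Matrix.of fun p k => if k = p.2 then G p.1 p.2 else 0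

/-- Kronecker product `y ⊗ x` of two vectors (indexed by `Fin m × Fin n`). -/
def vecKron {m n : ℕ} (y : Fin m → ℝ) (x : Fin n → ℝ) : Fin m × Fin n → ℝ :=
  fun p => y p.1 * x p.2

/-- The matrix `1_m^T ⊗ I_n` (after the canonical identification `Fin 1 × Fin n ≃ Fin n`). -/
def onesKronId (m n : ℕ) : Matrix (Fin n) (Fin m × Fin n) ℝ :=
  ((Matrix.of fun (_ : Fin 1) (_ : Fin m) => (1 : ℝ)) ⊗ₖ (1 : Matrix (Fin n) (Fin n) ℝ)).submatrix
    (fun k => ((0 : Fin 1), k)) id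

/-- The σ-algebra generated by `X_0, …, X_t`. -/
def sigmaUpTo {Ω α : Type*} [MeasurableSpace α] (X : ℕ → Ω → α) (t : ℕ) :
    MeasurableSpace Ω :=
  ⨆ s ∈ Finset.Iic t, MeasurableSpace.comap (X s) inferInstance

/-- The σ-algebra `𝓕_t = σ(X_0,…,X_t, Y_0,…,Y_t)`. -/
def filtF {Ω : Type*} {n m : ℕ} (X : ℕ → Ω → Fin n → ℝ) (Y : ℕ → Ω → Fin m → ℝ) (t : ℕ) :
    MeasurableSpace Ω :=
  sigmaUpTo X t ⊔ sigmaUpTo Y t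

/-- The σ-algebra `𝓖_t = σ(X_0,…,X_t, Y_0,…,Y_{t-1})` (so `𝓖_0 = σ(X_0)`). -/
def filtG {Ω : Type*} {n m : ℕ} (X : ℕ → Ω → Fin n → ℝ) (Y : ℕ → Ω → Fin m → ℝ) :
    ℕ → MeasurableSpace Ω
  | 0 => sigmaUpTo X 0
  | (t + 1) => sigmaUpTo X (t + 1) ⊔ sigmaUpTo Y t

/-- The `j`-th `n × n` block `Q_j` of an `(mn) × n` matrix `Q̄ = [Q_1; … ; Q_m]`. -/
def block {m n : ℕ} (Qbar : Matrix (Fin m × Fin n) (Fin n) ℝ) (j : Fin m) :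
    Matrix (Fin n) (Fin n) ℝ :=
  Matrix.of fun a b => Qbar (j, a) b

/-- The matrix `I_m ⊗ 1_n^T` (after the canonical identification `Fin m × Fin 1 ≃ Fin m`). -/
def idKronOnesRow (m n : ℕ) : Matrix (Fin m) (Fin m × Fin n) ℝ :=
  ((1 : Matrix (Fin m) (Fin m) ℝ) ⊗ₖ (Matrix.of fun (_ : Fin 1) (_ : Fin n) => (1 : ℝ))).submatrix
    (fun j => (j, (0 : Fin 1))) id

open Set in
/-- If `Y` is constant on `B`, adjoining `σ(Y)` to `m₁` does not change the trace on `B`. -/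
theorem exists_inter_eq_of_measurableSet_sup_comap {Ω α : Type*} [mα : MeasurableSpace α]
    {m₁ : MeasurableSpace Ω} {Y : Ω → α} {B : Set Ω} {c : α} (hY : ∀ ω ∈ B, Y ω = c)
    {S : Set Ω} (hS : MeasurableSet[m₁ ⊔ mα.comap Y] S) :
    ∃ A, MeasurableSet[m₁] A ∧ S ∩ B = A ∩ B := by
  have hconst : Y ∘ (Subtype.val : B → Ω) = fun _ => c := funext fun ω => hY ω ω.2
  have hcomap : (m₁ ⊔ mα.comap Y).comap (Subtype.val : B → Ω) = m₁.comap Subtype.val := by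
    rw [MeasurableSpace.comap_sup, MeasurableSpace.comap_comp, hconst,
      MeasurableSpace.comap_const, sup_bot_eq]
  have hpre : MeasurableSet[(m₁ ⊔ mα.comap Y).comap (Subtype.val : B → Ω)]
      (Subtype.val ⁻¹' S) := ⟨S, hS, rfl⟩
  rw [hcomap] at hpre
  obtain ⟨A, hA, hAS⟩ := hpre
  refine ⟨A, hA, ?_⟩
  rw [inter_comm S, inter_comm A]
  exact (Subtype.preimage_val_eq_preimage_val_iff B S A).1 hAS.symm

section Bayes

variable {Ω : Type*} {m₁ m₂ mΩ : MeasurableSpace Ω} {μ : Measure Ω} [IsProbabilityMeasure μ]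
  {B : Set Ω}

theorem condExp_indicator_one_pos (h₁ : m₁ ≤ mΩ) (hB : MeasurableSet B) :
    ∀ᵐ ω ∂μ, ω ∈ B → 0 < (μ[B.indicator (fun _ => (1 : ℝ)) | m₁]) ω := by
  set u : Ω → ℝ := B.indicator (fun _ => 1) with hu
  have hu0 : ∀ ω, 0 ≤ u ω := fun ω => Set.indicator_nonneg (fun _ _ => zero_le_one) ω
  have hui : Integrable u μ := (integrable_const 1).indicator hB
  set N : Set Ω := {ω | (μ[u | m₁]) ω ≤ 0}
  have hN : MeasurableSet[m₁] N :=
    (stronglyMeasurable_condExp (f := u) (μ := μ)).measurable measurableSet_Iic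
  have hle : ∫ ω in N, u ω ∂μ ≤ 0 := by
    rw [← setIntegral_condExp h₁ hui hN]
    exact setIntegral_nonpos (h₁ _ hN) fun ω hω => hω
  have hzero : u =ᵐ[μ.restrict N] 0 :=
    (integral_eq_zero_iff_of_nonneg hu0 hui.integrableOn).1
      (le_antisymm hle (integral_nonneg hu0))
  filter_upwards [(ae_restrict_iff' (h₁ _ hN)).1 hzero] with ω hω hωB
  by_contra hneg
  have := hω (not_lt.1 hneg)
  simp [hu, hωB] at this

/-- Bayes' rule: on an event `B` on which `m₁` and `m₂` have the same trace, conditioning on `m₂`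
is conditioning on `m₁` and on `B`. -/
theorem condExp_mul_condExp_indicator_ae_eq (h₁₂ : m₁ ≤ m₂) (h₂ : m₂ ≤ mΩ)
    (hB : MeasurableSet[m₂] B)
    (htrace : ∀ S, MeasurableSet[m₂] S → ∃ A, MeasurableSet[m₁] A ∧ S ∩ B = A ∩ B)
    {f : Ω → ℝ} (hf : Integrable f μ) :
    ∀ᵐ ω ∂μ, ω ∈ B → (μ[B.indicator (fun _ => (1 : ℝ)) | m₁]) ω * (μ[f | m₂]) ω
      = (μ[B.indicator (fun _ => (1 : ℝ)) * f | m₁]) ω := by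
  have h₁ := h₁₂.trans h₂
  set u : Ω → ℝ := B.indicator (fun _ => 1) with hu
  set p := μ[u | m₁]
  set q := μ[u * f | m₁]
  have hum : StronglyMeasurable[m₂] u := stronglyMeasurable_const.indicator hB
  have hui : Integrable u μ := (integrable_const 1).indicator (h₂ _ hB)
  have hub : ∀ ω, |u ω| ≤ 1 := fun ω => by
    by_cases h : ω ∈ B <;> simp [hu, h]
  have hpm : StronglyMeasurable[m₁] p := stronglyMeasurable_condExp
  have hqm : StronglyMeasurable[m₁] q := stronglyMeasurable_condExp
  have hpb : ∀ᵐ ω ∂μ, ‖p ω‖ ≤ 1 :=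
    ae_bdd_abs_condExp_of_ae_bdd_abs (R := 1) (Filter.Eventually.of_forall hub)
  have hmul_u : ∀ {g : Ω → ℝ}, Integrable g μ → Integrable (u * g) μ := fun hg =>
    hg.bdd_mul (hum.mono h₂).aestronglyMeasurable (Filter.Eventually.of_forall hub)
  have hmul_p : ∀ {g : Ω → ℝ}, Integrable g μ → Integrable (p * g) μ := fun hg =>
    hg.bdd_mul (hpm.mono h₁).aestronglyMeasurable hpb
  have huq : Integrable (u * q) μ := hmul_u integrable_condExp
  have hpuf : Integrable (p * (u * f)) μ := hmul_p (hmul_u hf)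
  have hupf : u * p * f = p * (u * f) := by ring
  have hset : ∀ {S A : Set Ω}, MeasurableSet S → MeasurableSet A → S ∩ B = A ∩ B →
      ∀ g : Ω → ℝ, ∫ ω in S, (u * g) ω ∂μ = ∫ ω in A, (u * g) ω ∂μ := by
    intro S A hS hA hSA g
    rw [← integral_indicator hS, ← integral_indicator hA]
    congr 1 with ω
    have hω : ω ∈ B → (ω ∈ S ↔ ω ∈ A) := fun h => by
      simpa [h] using Set.ext_iff.1 hSA ω
    by_cases h : ω ∈ B
    · by_cases hs : ω ∈ A
      · simp [hs, (hω h).2 hs]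
      · simp [hs, mt (hω h).1 hs]
    · have hug : (u * g) ω = 0 := by simp [hu, h]
      rw [Set.indicator_apply_eq_zero.2 fun _ => hug, Set.indicator_apply_eq_zero.2 fun _ => hug]
  have hpull : u * q =ᵐ[μ] μ[u * p * f | m₂] := by
    refine ae_eq_condExp_of_forall_setIntegral_eq h₂ (hupf ▸ hpuf)
      (fun _ _ _ => huq.integrableOn) (fun S hS _ => ?_)
      (hum.mul (hqm.mono h₁₂)).aestronglyMeasurable
    obtain ⟨A, hA, hSA⟩ := htrace S hS
    rw [mul_assoc, hset (h₂ _ hS) (h₁ _ hA) hSA q, hset (h₂ _ hS) (h₁ _ hA) hSA (p * f),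
      ← mul_assoc, hupf, ← setIntegral_condExp h₁ huq hA, ← setIntegral_condExp h₁ hpuf hA]
    refine setIntegral_congr_ae (h₁ _ hA) ?_
    filter_upwards [condExp_mul_of_stronglyMeasurable_right hqm huq hui,
      condExp_mul_of_stronglyMeasurable_left hpm hpuf (hmul_u hf)] with ω hω₁ hω₂ _
    rw [hω₁, hω₂]
  filter_upwards [hpull, condExp_mul_of_stronglyMeasurable_left (hum.mul (hpm.mono h₁₂))
    (hupf ▸ hpuf) hf] with ω hω₁ hω₂ hωB
  have := hω₁.trans hω₂
  simpa [hu, hωB] using this.symm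

end Bayes

theorem sigmaUpTo_succ {Ω α : Type*} [mα : MeasurableSpace α] (X : ℕ → Ω → α) (t : ℕ) :
    sigmaUpTo X (t + 1) = sigmaUpTo X t ⊔ mα.comap (X (t + 1)) := by
  simp only [sigmaUpTo, Finset.mem_Iic]
  exact Nat.iSup_le_succ (fun s => mα.comap (X s)) t

theorem sigmaUpTo_le {Ω α : Type*} [MeasurableSpace α] {mΩ : MeasurableSpace Ω} {X : ℕ → Ω → α}
    (hX : ∀ t, Measurable (X t)) (t : ℕ) : sigmaUpTo X t ≤ mΩ :=
  iSup₂_le fun s _ => (hX s).comap_le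

theorem sum_stdBasis (n : ℕ) (i : Fin n) : ∑ k, stdBasis n i k = 1 := by
  simp [_root_.stdBasis]

theorem abs_stdBasis_le_one (n : ℕ) (i k : Fin n) : |stdBasis n i k| ≤ 1 := by
  unfold _root_.stdBasis
  split_ifs <;> simp

theorem stdBasis_eq_indicator {Ω : Type*} {m : ℕ} {Y : Ω → Fin m → ℝ}
    (hY : ∀ ω, ∃ j, Y ω = stdBasis m j) (j : Fin m) :
    (fun ω => Y ω j) = {ω | Y ω = stdBasis m j}.indicator (fun _ => (1 : ℝ)) := by
  ext ω
  obtain ⟨i, hi⟩ := hY ω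
  by_cases hij : j = i
  · subst hij
    simp [hi, _root_.stdBasis]
  · have hne : stdBasis m i ≠ stdBasis m j := fun h => by
      simpa [_root_.stdBasis, hij] using congrFun h j
    simp [hi, hne, _root_.stdBasis, hij]

theorem integrable_coord_of_stdBasis {Ω : Type*} {mΩ : MeasurableSpace Ω} {n : ℕ}
    {μ : Measure Ω} [IsFiniteMeasure μ] {X : Ω → Fin n → ℝ} (hX : Measurable X)
    (hval : ∀ ω, ∃ i, X ω = stdBasis n i) (k : Fin n) : Integrable (fun ω => X ω k) μ := by
  refine Integrable.of_bound ((measurable_pi_apply k).comp hX).aestronglyMeasurable 1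
    (Filter.Eventually.of_forall fun ω => ?_)
  obtain ⟨i, hi⟩ := hval ω
  simpa [hi] using abs_stdBasis_le_one n i k

theorem integrable_vecKron {Ω : Type*} {mΩ : MeasurableSpace Ω} {m n : ℕ}
    {μ : Measure Ω} [IsFiniteMeasure μ] {Y : Ω → Fin m → ℝ} {X : Ω → Fin n → ℝ}
    (hX : Measurable X) (hY : Measurable Y) (hXval : ∀ ω, ∃ i, X ω = stdBasis n i)
    (hYval : ∀ ω, ∃ j, Y ω = stdBasis m j) (p : Fin m × Fin n) :
    Integrable (fun ω => vecKron (Y ω) (X ω) p) μ := by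
  refine (integrable_coord_of_stdBasis hX hXval p.2).bdd_mul (c := 1)
    ((measurable_pi_apply p.1).comp hY).aestronglyMeasurable
    (Filter.Eventually.of_forall fun ω => ?_)
  obtain ⟨j, hj⟩ := hYval ω
  simpa [hj] using abs_stdBasis_le_one m j p.1

theorem condExp_mulVec {Ω : Type*} {m₁ mΩ : MeasurableSpace Ω} {ι κ : Type*} [Fintype κ]
    {μ : Measure Ω} {X : Ω → κ → ℝ} (hX : ∀ k, Integrable (fun ω => X ω k) μ)
    (M : Matrix ι κ ℝ) (i : ι) :
    ∀ᵐ ω ∂μ, (μ[fun ω' => M.mulVec (X ω') i | m₁]) ω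
      = M.mulVec (fun k => (μ[fun ω' => X ω' k | m₁]) ω) i := by
  have hsum : (fun ω' => M.mulVec (X ω') i) = ∑ k, M i k • fun ω' => X ω' k := by
    ext ω
    simp [mulVec, dotProduct]
  rw [hsum]
  filter_upwards [condExp_finsetSum (s := Finset.univ) (fun k _ => (hX k).smul (M i k)) m₁,
    ae_all_iff.2 fun k => condExp_smul (μ := μ) (M i k) (fun ω' => X ω' k) m₁] with ω h₁ h₂
  simp [h₁, h₂, mulVec, dotProduct]

/-- **filter for `Σ_P`.** Suppose `E[Z_{t+1} | 𝓕_t] = Q̄ X_t` a.s. for all `t`,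
where `Z_t = Y_t ⊗ X_t` and `Q̄` has blocks `Q_1, …, Q_m`.  With `X̂_t = E[X_t | 𝓕^Y_t]`,
`A = ∑_j Q_j` and `C = (I_m ⊗ 1_n^T) Q̄`: a.s. on `{Y_t = f_j}` (`t ≥ 1`) one has
`1_n^T Q_j X̂_{t-1} > 0` and `X̂_t = Q_j X̂_{t-1} / (1_n^T Q_j X̂_{t-1})`; moreover
`E[X_{t+1} | 𝓕^Y_t] = A X̂_t` and `E[Y_{t+1} | 𝓕^Y_t] = C X̂_t` a.s. for all `t`. -/
theorem filter_sigmaP {Ω : Type*} {mΩ : MeasurableSpace Ω} {n m : ℕ}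
    (μ : Measure Ω) [IsProbabilityMeasure μ]
    (X : ℕ → Ω → Fin n → ℝ) (Y : ℕ → Ω → Fin m → ℝ)
    (hXmeas : ∀ t, Measurable (X t)) (hYmeas : ∀ t, Measurable (Y t))
    (hXval : ∀ t ω, ∃ i, X t ω = stdBasis n i)
    (hYval : ∀ t ω, ∃ j, Y t ω = stdBasis m j)
    (Qbar : Matrix (Fin m × Fin n) (Fin n) ℝ)
    -- `Z` is `𝓕`-Markov with one-step conditional expectations `Q̄ X_t`:
    (hZ : ∀ t, ∀ᵐ ω ∂μ, ∀ p : Fin m × Fin n,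
      (μ[fun ω' => vecKron (Y (t + 1) ω') (X (t + 1) ω') p | filtF X Y t]) ω
        = Qbar.mulVec (X t ω) p) :
    -- the recursive filter:
    (∀ (t : ℕ) (j : Fin m), ∀ᵐ ω ∂μ, Y (t + 1) ω = stdBasis m j →
      (0 < ∑ a, (block Qbar j).mulVec
          (fun k => (μ[fun ω' => X t ω' k | sigmaUpTo Y t]) ω) a)
      ∧ (∀ k, (μ[fun ω' => X (t + 1) ω' k | sigmaUpTo Y (t + 1)]) ω
          = (block Qbar j).mulVec
              (fun l => (μ[fun ω' => X t ω' l | sigmaUpTo Y t]) ω) k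
            / ∑ a, (block Qbar j).mulVec
                (fun l => (μ[fun ω' => X t ω' l | sigmaUpTo Y t]) ω) a))
    ∧
    -- the predictor `X̂_{t+1|t} = A X̂_t` with `A = ∑_j Q_j`:
    (∀ t : ℕ, ∀ᵐ ω ∂μ, ∀ k : Fin n,
      (μ[fun ω' => X (t + 1) ω' k | sigmaUpTo Y t]) ω
        = (∑ j, block Qbar j).mulVec
            (fun l => (μ[fun ω' => X t ω' l | sigmaUpTo Y t]) ω) k)
    ∧
    -- the predictor `Ŷ_{t+1|t} = C X̂_t` with `C = (I_m ⊗ 1_n^T) Q̄`: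
    (∀ t : ℕ, ∀ᵐ ω ∂μ, ∀ j' : Fin m,
      (μ[fun ω' => Y (t + 1) ω' j' | sigmaUpTo Y t]) ω
        = (idKronOnesRow m n * Qbar).mulVec
            (fun l => (μ[fun ω' => X t ω' l | sigmaUpTo Y t]) ω) j') := by
  have hYle := sigmaUpTo_le hYmeas
  have hFle : ∀ t, filtF X Y t ≤ mΩ := fun t => sup_le (sigmaUpTo_le hXmeas t) (hYle t)
  have hXint : ∀ t k, Integrable (fun ω => X t ω k) μ := fun t =>
    integrable_coord_of_stdBasis (hXmeas t) (hXval t)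
  have hZint : ∀ t p, Integrable (fun ω => vecKron (Y t ω) (X t ω) p) μ := fun t =>
    integrable_vecKron (hXmeas t) (hYmeas t) (hXval t) (hYval t)
  have hpred : ∀ t, ∀ᵐ ω ∂μ, ∀ p,
      (μ[fun ω' => vecKron (Y (t + 1) ω') (X (t + 1) ω') p | sigmaUpTo Y t]) ω
        = Qbar.mulVec (fun l => (μ[fun ω' => X t ω' l | sigmaUpTo Y t]) ω) p := by
    refine fun t => ae_all_iff.2 fun p => ?_
    have hYF : sigmaUpTo Y t ≤ filtF X Y t := le_sup_right
    have htower := condExp_condExp_of_le (μ := μ)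
      (f := fun ω' => vecKron (Y (t + 1) ω') (X (t + 1) ω') p) hYF (hFle t)
    have hstep : μ[fun ω' => vecKron (Y (t + 1) ω') (X (t + 1) ω') p | filtF X Y t]
        =ᵐ[μ] fun ω => Qbar.mulVec (X t ω) p := (hZ t).mono fun ω h => h p
    filter_upwards [htower, condExp_congr_ae (m := sigmaUpTo Y t) hstep,
      condExp_mulVec (m₁ := sigmaUpTo Y t) (hXint t) Qbar p] with ω h₁ h₂ h₃
    rw [← h₁, h₂, h₃]
  have hXpred : ∀ t : ℕ, ∀ᵐ ω ∂μ, ∀ k : Fin n,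
      (μ[fun ω' => X (t + 1) ω' k | sigmaUpTo Y t]) ω
        = ∑ j, Qbar.mulVec (fun l => (μ[fun ω' => X t ω' l | sigmaUpTo Y t]) ω) (j, k) := by
    refine fun t => ae_all_iff.2 fun k => ?_
    have hsum : (fun ω' => X (t + 1) ω' k)
        = ∑ j, fun ω' => vecKron (Y (t + 1) ω') (X (t + 1) ω') (j, k) := by
      ext ω
      obtain ⟨i, hi⟩ := hYval (t + 1) ω
      simp [vecKron, ← Finset.sum_mul, hi, sum_stdBasis]
    rw [hsum]
    filter_upwards [hpred t, condExp_finsetSum (s := Finset.univ)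
      (fun j _ => hZint (t + 1) (j, k)) (sigmaUpTo Y t)] with ω h₁ h₂
    simp [h₂, h₁]
  have hYpred : ∀ t : ℕ, ∀ᵐ ω ∂μ, ∀ j : Fin m,
      (μ[fun ω' => Y (t + 1) ω' j | sigmaUpTo Y t]) ω
        = ∑ k, Qbar.mulVec (fun l => (μ[fun ω' => X t ω' l | sigmaUpTo Y t]) ω) (j, k) := by
    refine fun t => ae_all_iff.2 fun j => ?_
    have hsum : (fun ω' => Y (t + 1) ω' j)
        = ∑ k, fun ω' => vecKron (Y (t + 1) ω') (X (t + 1) ω') (j, k) := by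
      ext ω
      obtain ⟨i, hi⟩ := hXval (t + 1) ω
      simp [vecKron, ← Finset.mul_sum, hi, sum_stdBasis]
    rw [hsum]
    filter_upwards [hpred t, condExp_finsetSum (s := Finset.univ)
      (fun k _ => hZint (t + 1) (j, k)) (sigmaUpTo Y t)] with ω h₁ h₂
    simp [h₂, h₁]
  have hblock : ∀ (j : Fin m) (v : Fin n → ℝ) (k : Fin n),
      (block Qbar j).mulVec v k = Qbar.mulVec v (j, k) := fun _ _ _ => rfl
  refine ⟨fun t j => ?_, fun t => ?_, fun t => ?_⟩
  · have hsucc := sigmaUpTo_succ Y t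
    have h₁₂ : sigmaUpTo Y t ≤ sigmaUpTo Y (t + 1) := hsucc ▸ le_sup_left
    have hBm : MeasurableSet[sigmaUpTo Y (t + 1)] {ω | Y (t + 1) ω = stdBasis m j} := by
      rw [hsucc]
      exact (le_sup_right : _ ≤ sigmaUpTo Y t ⊔ _) _
        ⟨{stdBasis m j}, measurableSet_singleton _, rfl⟩
    have hBayes : ∀ k, _ := fun k =>
      condExp_mul_condExp_indicator_ae_eq h₁₂ (hYle (t + 1)) hBm
        (fun S hS => exists_inter_eq_of_measurableSet_sup_comap (Y := Y (t + 1))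
          (fun _ hω => hω) (hsucc ▸ hS)) (hXint (t + 1) k)
    have hpos := condExp_indicator_one_pos (μ := μ) (hYle t) (hYle (t + 1) _ hBm)
    rw [← stdBasis_eq_indicator (hYval (t + 1)) j] at hpos
    simp only [← stdBasis_eq_indicator (hYval (t + 1)) j] at hBayes
    filter_upwards [hpred t, hYpred t, hpos, ae_all_iff.2 hBayes] with ω hZω hYω hposω hBω hω
    simp only [hblock, ← hYω j]
    refine ⟨hposω hω, fun k => ?_⟩
    rw [eq_div_iff (hposω hω).ne', mul_comm, hBω k hω, ← hZω (j, k)]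
    rfl
  · filter_upwards [hXpred t] with ω hω k
    rw [hω k, Matrix.sum_mulVec, Finset.sum_apply]
    rfl
  · filter_upwards [hYpred t] with ω hω j
    rw [hω j, ← Matrix.mulVec_mulVec]
    simp only [idKronOnesRow, mulVec, dotProduct, Fintype.sum_prod_type]
    symm
    rw [Finset.sum_comm]
    simp [Matrix.one_apply]
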